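/- arXiv:1408.2105 — 2 statements merged into one kernel-verified Lean document; each statement's English description precedes it below -/
import Mathlib

section
/- For every natural number s ≥ 5, the polynomial det M_s is nonzero and homogeneous of degree 3s (in particular its total degree is 3s). Hence the hypersurfaces defined by det M_s for s = 7, 11, 15 have degrees 21, 33, and 45, respectively. -/
open scoped BigOperators

/-- The exterior flattening of a tensor `t` (skew-symmetric in its last two indices). -/
def extFlattening {n : ℕ} {R : Type*} [CommRing R] (t : Fin 3 → Fin n → Fin n → R) :
    Matrix (Fin 3 × Fin n) (Fin 3 × Fin n) R := fun p q =>
  if p.1 = 0 ∧ q.1 = 1 then t 0 p.2 q.2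
  else if p.1 = 1 ∧ q.1 = 0 then -t 0 p.2 q.2
  else if p.1 = 0 ∧ q.1 = 2 then -t 1 p.2 q.2
  else if p.1 = 2 ∧ q.1 = 0 then t 1 p.2 q.2
  else if p.1 = 1 ∧ q.1 = 2 then t 2 p.2 q.2
  else if p.1 = 2 ∧ q.1 = 1 then -t 2 p.2 q.2
  else 0

/-- The generic skew-symmetric tensor with `MvPolynomial` entries. -/
noncomputable def genericSkew (s : ℕ) :
    Fin 3 → Fin s → Fin s → MvPolynomial (Fin 3 × Fin s × Fin s) ℂ := fun m k l =>
  if k < l then MvPolynomial.X (m, k, l)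
  else if l < k then -MvPolynomial.X (m, l, k)
  else 0

/-- `det M_s`, the determinant of the ⊠-product of a generic `3×3` skew-symmetric
matrix with a generic `s×s` skew-symmetric matrix. -/
noncomputable def detM (s : ℕ) : MvPolynomial (Fin 3 × Fin s × Fin s) ℂ :=
  (extFlattening (genericSkew s)).det

open Matrix in
/-- `ι` indexes three skew-symmetric matrices whose exterior flattening, written out blockwise,
has trivial kernel. -/
def HasNondegenerateSkewTriple (ι K : Type*) [Fintype ι] [CommRing K] : Prop :=
  ∃ A B C : Matrix ι ι K, Aᵀ = -A ∧ Bᵀ = -B ∧ Cᵀ = -C ∧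
    ∀ u v w : ι → K, A *ᵥ v = B *ᵥ w → A *ᵥ u = C *ᵥ w → B *ᵥ u = C *ᵥ v →
      u = 0 ∧ v = 0 ∧ w = 0

namespace HasNondegenerateSkewTriple

open Matrix

variable {ι κ K : Type*} [Fintype ι] [Fintype κ] [CommRing K]

theorem congr (e : ι ≃ κ) (h : HasNondegenerateSkewTriple ι K) :
    HasNondegenerateSkewTriple κ K := by
  obtain ⟨A, B, C, hA, hB, hC, h⟩ := h
  have key (D : Matrix ι ι K) (x : κ → K) :
      reindex e e D *ᵥ x = (D *ᵥ (x ∘ e)) ∘ e.symm := by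
    simp [submatrix_mulVec_equiv]
  have cancel (f g : ι → K) (hfg : f ∘ e.symm = g ∘ e.symm) : f = g :=
    e.symm.surjective.injective_comp_right hfg
  have zero (x : κ → K) (hx : x ∘ e = 0) : x = 0 :=
    e.surjective.injective_comp_right hx
  refine ⟨reindex e e A, reindex e e B, reindex e e C, ?_, ?_, ?_, fun u v w h₁ h₂ h₃ => ?_⟩
  · rw [transpose_reindex, hA]; rfl
  · rw [transpose_reindex, hB]; rfl
  · rw [transpose_reindex, hC]; rfl
  · simp only [key] at h₁ h₂ h₃
    obtain ⟨hu, hv, hw⟩ := h _ _ _ (cancel _ _ h₁) (cancel _ _ h₂) (cancel _ _ h₃)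
    exact ⟨zero u hu, zero v hv, zero w hw⟩

theorem sum (h : HasNondegenerateSkewTriple ι K) (h' : HasNondegenerateSkewTriple κ K) :
    HasNondegenerateSkewTriple (ι ⊕ κ) K := by
  obtain ⟨A, B, C, hA, hB, hC, h⟩ := h
  obtain ⟨A', B', C', hA', hB', hC', h'⟩ := h'
  have elim_zero (x : ι ⊕ κ → K) (hl : x ∘ Sum.inl = 0) (hr : x ∘ Sum.inr = 0) : x = 0 := by
    rw [← Sum.elim_comp_inl_inr x, hl, hr, Sum.elim_zero_zero]
  refine ⟨fromBlocks A 0 0 A', fromBlocks B 0 0 B', fromBlocks C 0 0 C', ?_, ?_, ?_,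
    fun u v w h₁ h₂ h₃ => ?_⟩
  · simp [fromBlocks_transpose, fromBlocks_neg, hA, hA']
  · simp [fromBlocks_transpose, fromBlocks_neg, hB, hB']
  · simp [fromBlocks_transpose, fromBlocks_neg, hC, hC']
  · simp only [fromBlocks_mulVec, zero_mulVec, add_zero, zero_add, Sum.elim_eq_iff] at h₁ h₂ h₃
    obtain ⟨hu, hv, hw⟩ := h _ _ _ h₁.1 h₂.1 h₃.1
    obtain ⟨hu', hv', hw'⟩ := h' _ _ _ h₁.2 h₂.2 h₃.2
    exact ⟨elim_zero u hu hu', elim_zero v hv hv', elim_zero w hw hw'⟩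

end HasNondegenerateSkewTriple

section SmallCases

variable (K : Type*) [Field K] [CharZero K]

/-- The standard basis of the Lie algebra `𝔰𝔬₃`. -/
theorem hasNondegenerateSkewTriple_three : HasNondegenerateSkewTriple (Fin 3) K := by
  refine ⟨!![0, 1, 0; -1, 0, 0; 0, 0, 0], !![0, 0, 1; 0, 0, 0; -1, 0, 0],
    !![0, 0, 0; 0, 0, 1; 0, -1, 0], ?_, ?_, ?_, fun u v w h₁ h₂ h₃ => ?_⟩
  iterate 3
    · ext i j
      fin_cases i <;> fin_cases j <;> simp
  simp only [funext_iff, Fin.forall_fin_succ] at h₁ h₂ h₃ ⊢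
  simp [Matrix.mulVec, Matrix.vecHead, Matrix.vecTail] at h₁ h₂ h₃ ⊢
  grind

/-- Left multiplication by the imaginary quaternion units. -/
theorem hasNondegenerateSkewTriple_four : HasNondegenerateSkewTriple (Fin 4) K := by
  refine ⟨!![0, -1, 0, 0; 1, 0, 0, 0; 0, 0, 0, -1; 0, 0, 1, 0],
    !![0, 0, -1, 0; 0, 0, 0, 1; 1, 0, 0, 0; 0, -1, 0, 0],
    !![0, 0, 0, -1; 0, 0, -1, 0; 0, 1, 0, 0; 1, 0, 0, 0], ?_, ?_, ?_, fun u v w h₁ h₂ h₃ => ?_⟩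
  iterate 3
    · ext i j
      fin_cases i <;> fin_cases j <;> simp
  simp only [funext_iff, Fin.forall_fin_succ] at h₁ h₂ h₃ ⊢
  simp [Matrix.mulVec, Matrix.vecHead, Matrix.vecTail] at h₁ h₂ h₃ ⊢
  grind

theorem hasNondegenerateSkewTriple_five : HasNondegenerateSkewTriple (Fin 5) K := by
  refine ⟨!![0, 0, 1, 0, 0; 0, 0, 0, 0, 0; -1, 0, 0, 0, 0; 0, 0, 0, 0, 1; 0, 0, 0, -1, 0],
    !![0, 0, 0, 1, 0; 0, 0, 0, 0, 1; 0, 0, 0, 0, 0; -1, 0, 0, 0, 0; 0, -1, 0, 0, 0],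
    !![0, 1, 0, 0, 0; -1, 0, 0, 0, 0; 0, 0, 0, 1, 0; 0, 0, -1, 0, 0; 0, 0, 0, 0, 0],
    ?_, ?_, ?_, fun u v w h₁ h₂ h₃ => ?_⟩
  iterate 3
    · ext i j
      fin_cases i <;> fin_cases j <;> simp
  simp only [funext_iff, Fin.forall_fin_succ] at h₁ h₂ h₃ ⊢
  simp [Matrix.mulVec, Matrix.vecHead, Matrix.vecTail] at h₁ h₂ h₃ ⊢
  grind

end SmallCases

theorem hasNondegenerateSkewTriple_fin (K : Type*) [Field K] [CharZero K] (s : ℕ) (hs : 3 ≤ s) :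
    HasNondegenerateSkewTriple (Fin s) K := by
  induction s using Nat.strong_induction_on with
  | _ s ih =>
    by_cases h : s < 6
    · interval_cases s
      · exact hasNondegenerateSkewTriple_three K
      · exact hasNondegenerateSkewTriple_four K
      · exact hasNondegenerateSkewTriple_five K
    · obtain ⟨r, rfl⟩ := Nat.exists_eq_add_of_le hs
      exact ((hasNondegenerateSkewTriple_three K).sum (ih r (by omega) (by omega))).congr
        finSumFinEquiv

open Matrix in
theorem HasNondegenerateSkewTriple.exists_det_extFlattening_ne_zero {n : ℕ} {K : Type*} [Field K]
    (h : HasNondegenerateSkewTriple (Fin n) K) :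
    ∃ t : Fin 3 → Matrix (Fin n) (Fin n) K,
      (∀ m, (t m)ᵀ = -t m) ∧ (extFlattening t).det ≠ 0 := by
  obtain ⟨A, B, C, hA, hB, hC, h⟩ := h
  refine ⟨![A, B, C], fun m => ?_, fun hdet => ?_⟩
  · fin_cases m
    exacts [hA, hB, hC]
  obtain ⟨x, hx, hx0⟩ := exists_mulVec_eq_zero_iff.2 hdet
  have row (p : Fin 3) (k : Fin n) := congrFun hx0 (p, k)
  simp only [mulVec, dotProduct, Fintype.sum_prod_type, Fin.sum_univ_three] at row
  obtain ⟨h0, h1, h2⟩ := h (fun l => x (0, l)) (fun l => x (1, l)) (fun l => x (2, l))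
    (funext fun k => by
      have : ∑ l, 0 * x (0, l) + ∑ l, A k l * x (1, l) + ∑ l, -B k l * x (2, l) = 0 := row 0 k
      simpa [mulVec, dotProduct, add_neg_eq_zero] using this)
    (funext fun k => by
      have : ∑ l, -A k l * x (0, l) + ∑ l, 0 * x (1, l) + ∑ l, C k l * x (2, l) = 0 := row 1 k
      simpa [mulVec, dotProduct, neg_add_eq_zero] using this)
    (funext fun k => by
      have : ∑ l, B k l * x (0, l) + ∑ l, -C k l * x (1, l) + ∑ l, 0 * x (2, l) = 0 := row 2 k
      simpa [mulVec, dotProduct, add_neg_eq_zero] using this)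
  refine hx (funext fun ⟨p, l⟩ => ?_)
  fin_cases p
  exacts [congrFun h0 l, congrFun h1 l, congrFun h2 l]

open Matrix in
theorem eval_detM {s : ℕ} (t : Fin 3 → Matrix (Fin s) (Fin s) ℂ) (ht : ∀ m, (t m)ᵀ = -t m) :
    MvPolynomial.eval (fun p => t p.1 p.2.1 p.2.2) (detM s) = (extFlattening t).det := by
  have skew (m k l) : t m l k = -t m k l := congrFun (congrFun (ht m) k) l
  have diag (m k) : t m k k = 0 := self_eq_neg.1 (skew m k k)
  have entry (m k l) :
      MvPolynomial.eval (fun p => t p.1 p.2.1 p.2.2) (genericSkew s m k l) = t m k l := by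
    unfold genericSkew
    split_ifs with h₁ h₂
    · simp
    · simp [skew m k l]
    · obtain rfl : k = l := le_antisymm (not_lt.1 h₂) (not_lt.1 h₁)
      simp [diag]
  rw [detM, RingHom.map_det]
  congr 1
  ext p q
  simp only [RingHom.mapMatrix_apply, map_apply, extFlattening]
  split_ifs <;> simp [entry]

theorem isHomogeneous_genericSkew (s : ℕ) (m : Fin 3) (k l : Fin s) :
    (genericSkew s m k l).IsHomogeneous 1 := by
  unfold genericSkew
  split_ifs
  · exact MvPolynomial.isHomogeneous_X _ _
  · exact (MvPolynomial.isHomogeneous_X _ _).neg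
  · exact MvPolynomial.isHomogeneous_zero _ _ _

theorem Matrix.isHomogeneous_det {ι σ R : Type*} [Fintype ι] [DecidableEq ι] [CommRing R]
    (M : Matrix ι ι (MvPolynomial σ R)) (d : ℕ) (hM : ∀ i j, (M i j).IsHomogeneous d) :
    M.det.IsHomogeneous (Fintype.card ι * d) := by
  rw [Matrix.det_apply]
  refine MvPolynomial.IsHomogeneous.sum _ _ _ fun τ _ => ?_
  have h : (∏ i, M (τ i) i).IsHomogeneous (Fintype.card ι * d) := by
    simpa using MvPolynomial.IsHomogeneous.prod Finset.univ (fun i => M (τ i) i) (fun _ => d)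
      fun i _ => hM _ _
  rcases Int.units_eq_one_or (Equiv.Perm.sign τ) with hτ | hτ
  · simpa [hτ] using h
  · simpa [hτ] using h.neg

theorem isHomogeneous_detM (s : ℕ) : (detM s).IsHomogeneous (3 * s) := by
  have entry (p q) : (extFlattening (genericSkew s) p q).IsHomogeneous 1 := by
    unfold extFlattening
    split_ifs
    all_goals first
      | exact isHomogeneous_genericSkew _ _ _ _
      | exact (isHomogeneous_genericSkew _ _ _ _).neg
      | exact MvPolynomial.isHomogeneous_zero _ _ _
  simpa [detM] using Matrix.isHomogeneous_det _ 1 entry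

theorem detM_ne_zero (s : ℕ) (hs : 3 ≤ s) : detM s ≠ 0 := by
  obtain ⟨t, ht, hdet⟩ :=
    (hasNondegenerateSkewTriple_fin ℂ s hs).exists_det_extFlattening_ne_zero
  rintro h
  exact hdet (by rw [← eval_detM t ht, h, map_zero])

/-- For every `s ≥ 5`, `det M_s` is nonzero and homogeneous of degree `3s`
(in particular its total degree is `3s`); hence the hypersurfaces it defines for
`s = 7, 11, 15` have degrees `21`, `33`, `45`. -/
theorem detM_ne_zero_and_homogeneous (s : ℕ) (hs : 5 ≤ s) :
    detM s ≠ 0 ∧ MvPolynomial.IsHomogeneous (detM s) (3 * s) ∧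
      (detM s).totalDegree = 3 * s := by
  have hne := detM_ne_zero s (by omega)
  exact ⟨hne, isHomogeneous_detM s, (isHomogeneous_detM s).totalDegree hne⟩
end

section
/- For every ℓ ≥ 1, setting n = 4ℓ+3, there exists a tensor t : Fin 3 → Fin n → Fin n → ℂ, skew-symmetric in its last two indices, such that the exterior flattening Φ(t) has nonzero determinant (i.e., Φ(t) is invertible). Consequently, a general tensor in ℂ³ ⊗ ⋀²ℂ^{4ℓ+3} has invertible exterior flattening. -/
open scoped BigOperators

/-- The direct sum of two tensors, acting on the two blocks of `Fin (n + m)`. -/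
def tensorDirectSum {n m : ℕ} {R : Type*} [CommRing R] (t : Fin 3 → Fin n → Fin n → R)
    (s : Fin 3 → Fin m → Fin m → R) : Fin 3 → Fin (n + m) → Fin (n + m) → R :=
  fun i => (Matrix.fromBlocks (Matrix.of (t i)) 0 0 (Matrix.of (s i))).submatrix
    finSumFinEquiv.symm finSumFinEquiv.symm

theorem tensorDirectSum_skew {n m : ℕ} {R : Type*} [CommRing R]
    {t : Fin 3 → Fin n → Fin n → R} {s : Fin 3 → Fin m → Fin m → R}
    (ht : ∀ i k l, t i k l = -t i l k) (hs : ∀ i k l, s i k l = -s i l k) (i : Fin 3)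
    (k l : Fin (n + m)) : tensorDirectSum t s i k l = -tensorDirectSum t s i l k := by
  obtain ⟨k, rfl⟩ := finSumFinEquiv.surjective k
  obtain ⟨l, rfl⟩ := finSumFinEquiv.surjective l
  rcases k with k | k <;> rcases l with l | l <;>
    simp only [tensorDirectSum, Matrix.submatrix_apply, Equiv.symm_apply_apply,
      Matrix.fromBlocks_apply₁₁, Matrix.fromBlocks_apply₁₂, Matrix.fromBlocks_apply₂₁,
      Matrix.fromBlocks_apply₂₂, Matrix.of_apply, Matrix.zero_apply, neg_zero]
  exacts [ht i k l, hs i k l]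

theorem det_extFlattening_tensorDirectSum {n m : ℕ} {R : Type*} [CommRing R]
    (t : Fin 3 → Fin n → Fin n → R) (s : Fin 3 → Fin m → Fin m → R) :
    (extFlattening (tensorDirectSum t s)).det = (extFlattening t).det * (extFlattening s).det := by
  let e : (Fin 3 × Fin n) ⊕ (Fin 3 × Fin m) ≃ Fin 3 × Fin (n + m) :=
    (Equiv.prodSumDistrib _ _ _).symm.trans ((Equiv.refl _).prodCongr finSumFinEquiv)
  rw [← Matrix.det_fromBlocks_zero₁₂ _ 0, ← Matrix.det_submatrix_equiv_self e]
  congr 1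
  ext (⟨i, k⟩ | ⟨i, k⟩) (⟨j, l⟩ | ⟨j, l⟩) <;>
    simp [e, extFlattening, tensorDirectSum]

theorem extFlattening_map {n : ℕ} {R S : Type*} [CommRing R] [CommRing S] (f : R →+* S)
    (t : Fin 3 → Fin n → Fin n → R) :
    extFlattening (fun i k l => f (t i k l)) = f.mapMatrix (extFlattening t) := by
  ext p q
  simp only [extFlattening, RingHom.mapMatrix_apply, Matrix.map_apply]
  split_ifs <;> simp

/-- The structure tensor of `𝔰𝔬₃` in its vector representation. -/
def vectorTensor : Fin 3 → Fin 3 → Fin 3 → ℤ :=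
  ![![![0, 1, 0], ![-1, 0, 0], ![0, 0, 0]],
    ![![0, 0, -1], ![0, 0, 0], ![1, 0, 0]],
    ![![0, 0, 0], ![0, 0, 1], ![0, -1, 0]]]

/-- The tensor of left multiplication by the imaginary quaternion units. -/
def quaternionTensor : Fin 3 → Fin 4 → Fin 4 → ℤ :=
  ![![![0, 1, 0, 0], ![-1, 0, 0, 0], ![0, 0, 0, 1], ![0, 0, -1, 0]],
    ![![0, 0, -1, 0], ![0, 0, 0, 1], ![1, 0, 0, 0], ![0, -1, 0, 0]],
    ![![0, 0, 0, 1], ![0, 0, 1, 0], ![0, -1, 0, 0], ![-1, 0, 0, 0]]]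

theorem det_ne_zero_of_mul_eq_two {ι : Type*} [Fintype ι] [DecidableEq ι] {M N : Matrix ι ι ℤ}
    (h : M * N = 2) : M.det ≠ 0 := by
  refine left_ne_zero_of_mul (b := N.det) ?_
  rw [← Matrix.det_mul, h, ← Matrix.diagonal_ofNat, Matrix.det_diagonal]
  simp

theorem det_extFlattening_vectorTensor : (extFlattening vectorTensor).det ≠ 0 := by
  apply det_ne_zero_of_mul_eq_two
    (N := 1 - extFlattening vectorTensor * (extFlattening vectorTensor - 2))
  decide +kernel

theorem det_extFlattening_quaternionTensor : (extFlattening quaternionTensor).det ≠ 0 := by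
  apply det_ne_zero_of_mul_eq_two (N := extFlattening quaternionTensor - 1)
  decide +kernel

theorem exists_int_extFlattening_det_ne_zero (ℓ : ℕ) :
    ∃ t : Fin 3 → Fin (4 * ℓ + 3) → Fin (4 * ℓ + 3) → ℤ,
      (∀ m k l, t m k l = -t m l k) ∧ (extFlattening t).det ≠ 0 := by
  induction ℓ with
  | zero => exact ⟨vectorTensor, by decide, det_extFlattening_vectorTensor⟩
  | succ ℓ ih =>
    obtain ⟨t, ht, hdet⟩ := ih
    rw [show 4 * (ℓ + 1) + 3 = 4 * ℓ + 3 + 4 by ring]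
    refine ⟨tensorDirectSum t quaternionTensor, tensorDirectSum_skew ht (by decide), ?_⟩
    rw [det_extFlattening_tensorDirectSum]
    exact mul_ne_zero hdet det_extFlattening_quaternionTensor

/-- For every `ℓ ≥ 1` there is a partially skew-symmetric tensor in
`ℂ³ ⊗ ⋀²ℂ^{4ℓ+3}` whose exterior flattening has nonzero determinant; hence a general
such tensor has invertible exterior flattening. -/
theorem exists_extFlattening_det_ne_zero (ℓ : ℕ) (hℓ : 1 ≤ ℓ) :
    ∃ t : Fin 3 → Fin (4 * ℓ + 3) → Fin (4 * ℓ + 3) → ℂ,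
      (∀ m k l, t m k l = -t m l k) ∧ (extFlattening t).det ≠ 0 := by
  obtain ⟨t, ht, hdet⟩ := exists_int_extFlattening_det_ne_zero ℓ
  refine ⟨fun i k l => Int.castRingHom ℂ (t i k l), fun i k l => ?_, ?_⟩
  · simp only [ht i k l, map_neg]
  · rw [extFlattening_map, ← RingHom.map_det]
    simpa using hdet
end
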